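/- Let ψ be a unit vector in ℂ^{d_A} ⊗ ℂ^{d_B}, let ρ_{AB} = |ψ⟩⟨ψ|, let ρ_A = Tr_B ρ_{AB}, ρ_B = Tr_A ρ_{AB} be its marginals, and let r be the rank of ρ_A (the Schmidt rank of ψ). Then for every α ∈ (1,2), the sandwiched Rényi divergence satisfies D̃_α(ρ_{AB} ‖ ρ_A ⊗ ρ_B) ≤ 2·log r. -/

import Mathlib

open scoped Kronecker
open Matrix

/-- Partial trace over the second (B) system. -/
noncomputable def ptraceB {A B : Type*} [Fintype B]
    (ρ : Matrix (A × B) (A × B) ℂ) : Matrix A A ℂ :=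
  Matrix.of fun a a' => ∑ b, ρ (a, b) (a', b)

/-- Partial trace over the first (A) system. -/
noncomputable def ptraceA {A B : Type*} [Fintype A]
    (ρ : Matrix (A × B) (A × B) ℂ) : Matrix B B ℂ :=
  Matrix.of fun b b' => ∑ a, ρ (a, b) (a, b')

/-- Real power of a Hermitian matrix via spectral decomposition, convention `0^r = 0`
on the kernel; junk value `0` for non-Hermitian matrices. -/
noncomputable def mPow {n : Type*} [Fintype n] [DecidableEq n]
    (M : Matrix n n ℂ) (r : ℝ) : Matrix n n ℂ :=
  if h : M.IsHermitian then
    (h.eigenvectorUnitary : Matrix n n ℂ) *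
      Matrix.diagonal
        (fun i => ((if h.eigenvalues i = 0 then (0 : ℝ) else h.eigenvalues i ^ r : ℝ) : ℂ)) *
      star (h.eigenvectorUnitary : Matrix n n ℂ)
  else 0

/-- Sandwiched Rényi divergence
`D̃_α(ρ‖σ) = (α−1)⁻¹ log Tr[(σ^{(1−α)/(2α)} ρ σ^{(1−α)/(2α)})^α]`. -/
noncomputable def sandwichedRenyiDiv {n : Type*} [Fintype n] [DecidableEq n]
    (α : ℝ) (ρ σ : Matrix n n ℂ) : ℝ :=
  (α - 1)⁻¹ *
    Real.log (Matrix.trace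
      (mPow (mPow σ ((1 - α) / (2 * α)) * ρ * mPow σ ((1 - α) / (2 * α))) α)).re

open scoped ComplexOrder

section CoefficientMatrix

variable {m n : Type*} [Fintype m] [Fintype n]

/-- Among nonnegative families with sum `1`, `∑ p ^ q` over the support is at most
`(#support) ^ (1 - q)`. -/
lemma sum_rpow_support_le {p : n → ℝ} (hp : ∀ i, 0 ≤ p i) (hsum : ∑ i, p i = 1)
    {q : ℝ} (hq0 : 0 < q) (hq1 : q ≤ 1) :
    ∑ i with p i ≠ 0, p i ^ q ≤ (Fintype.card {i // p i ≠ 0} : ℝ) ^ (1 - q) := by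
  have h := Real.rpow_sum_le_const_mul_sum_rpow_of_nonneg (s := {i | p i ≠ 0})
    (f := fun i => p i ^ q) (p := q⁻¹) ((one_le_inv₀ hq0).2 hq1)
    (fun i _ => Real.rpow_nonneg (hp i) q)
  have hs : ∑ i with p i ≠ 0, (p i ^ q) ^ q⁻¹ = 1 := by
    simp_rw [fun i => Real.rpow_rpow_inv (hp i) hq0.ne']
    rw [Finset.sum_filter_ne_zero, hsum]
  rw [hs, mul_one, ← Fintype.card_subtype] at h
  have h0 : 0 ≤ ∑ i with p i ≠ 0, p i ^ q := Finset.sum_nonneg fun i _ => Real.rpow_nonneg (hp i) q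
  have h2 := Real.rpow_le_rpow (Real.rpow_nonneg h0 _) h hq0.le
  rw [Real.rpow_inv_rpow h0 hq0.ne', ← Real.rpow_mul (Nat.cast_nonneg _), sub_mul,
    inv_mul_cancel₀ hq0.ne', one_mul] at h2
  exact h2

lemma ptraceB_vecMulVec {m n : Type*} [Fintype n] (ψ : m × n → ℂ) :
    ptraceB (vecMulVec ψ (star ψ)) =
      (of fun a b => ψ (a, b)) * (of fun a b => ψ (a, b) : Matrix m n ℂ)ᴴ := by
  ext a a'
  simp [ptraceB, vecMulVec_apply, Matrix.mul_apply]

lemma ptraceA_vecMulVec {m n : Type*} [Fintype m] (ψ : m × n → ℂ) :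
    ptraceA (vecMulVec ψ (star ψ)) =
      (of fun a b => ψ (a, b) : Matrix m n ℂ)ᵀ * (of fun a b => ψ (a, b) : Matrix m n ℂ)ᵀᴴ := by
  ext a a'
  simp [ptraceA, vecMulVec_apply, Matrix.mul_apply]

/-- Coefficient-matrix form of `(X ⊗ Y) ψ`. -/
lemma kronecker_mulVec_apply (X : Matrix m m ℂ) (Y : Matrix n n ℂ) (ψ : m × n → ℂ) (a : m) (b : n) :
    ((X ⊗ₖ Y) *ᵥ ψ) (a, b) = (X * (of fun a b => ψ (a, b)) * Yᵀ) a b := by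
  simp only [mulVec, dotProduct, Fintype.sum_prod_type, kroneckerMap_apply, Matrix.mul_apply,
    of_apply, transpose_apply, Finset.sum_mul]
  rw [Finset.sum_comm]
  exact Finset.sum_congr rfl fun _ _ => Finset.sum_congr rfl fun _ _ => by ring

lemma star_dotProduct_self_eq_trace (φ : m × n → ℂ) :
    star φ ⬝ᵥ φ = ((of fun a b => φ (a, b) : Matrix m n ℂ)ᴴ * of fun a b => φ (a, b)).trace := by
  simp only [dotProduct, Fintype.sum_prod_type, trace, diag, Matrix.mul_apply, conjTranspose_apply,
    of_apply, Pi.star_apply]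
  exact Finset.sum_comm

end CoefficientMatrix

section MatrixPower

variable {m n : Type*} [Fintype m] [DecidableEq m] [Fintype n] [DecidableEq n]

/-- The scalar power function underlying `mPow`, with `0 ^ r = 0` for every `r`. -/
noncomputable def suppRpow (r x : ℝ) : ℝ := if x = 0 then 0 else x ^ r

lemma suppRpow_mul {x y : ℝ} (hx : 0 ≤ x) (hy : 0 ≤ y) (r : ℝ) :
    suppRpow r (x * y) = suppRpow r x * suppRpow r y := by
  unfold suppRpow
  by_cases h1 : x = 0
  · simp [h1]
  by_cases h2 : y = 0
  · simp [h2]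
  simp [h1, h2, Real.mul_rpow hx hy]

lemma eq_eigenvectorUnitary_mul_diagonal_mul {M : Matrix n n ℂ} (h : M.IsHermitian) :
    M = (h.eigenvectorUnitary : Matrix n n ℂ) *
      diagonal (fun i => ((h.eigenvalues i : ℝ) : ℂ)) *
      (h.eigenvectorUnitary : Matrix n n ℂ)ᴴ := by
  conv_lhs => rw [h.spectral_theorem]
  rfl

lemma mPow_eq {M : Matrix n n ℂ} (h : M.IsHermitian) (r : ℝ) :
    mPow M r = (h.eigenvectorUnitary : Matrix n n ℂ) *
      diagonal (fun i => ((suppRpow r (h.eigenvalues i) : ℝ) : ℂ)) *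
      (h.eigenvectorUnitary : Matrix n n ℂ)ᴴ := by
  simp only [mPow, dif_pos h]
  rfl

lemma conjTranspose_mul_eigenvectorUnitary {M : Matrix n n ℂ} (h : M.IsHermitian) :
    (h.eigenvectorUnitary : Matrix n n ℂ)ᴴ * (h.eigenvectorUnitary : Matrix n n ℂ) = 1 :=
  Unitary.coe_star_mul_self h.eigenvectorUnitary

lemma eigenvectorUnitary_mul_conjTranspose {M : Matrix n n ℂ} (h : M.IsHermitian) :
    (h.eigenvectorUnitary : Matrix n n ℂ) * (h.eigenvectorUnitary : Matrix n n ℂ)ᴴ = 1 :=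
  Unitary.coe_mul_star_self h.eigenvectorUnitary

/-- A matrix intertwining two unitarily diagonalised matrices intertwines any function of them. -/
lemma intertwine_diagonal {W : Matrix m m ℂ} {V : Matrix n n ℂ} {X : Matrix m n ℂ}
    {d : m → ℝ} {e : n → ℝ} (f : ℝ → ℝ)
    (hW : Wᴴ * W = 1) (hW' : W * Wᴴ = 1) (hV : Vᴴ * V = 1) (hV' : V * Vᴴ = 1)
    (h : (W * diagonal (fun i => ((d i : ℝ) : ℂ)) * Wᴴ) * X =
      X * (V * diagonal (fun i => ((e i : ℝ) : ℂ)) * Vᴴ)) :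
    (W * diagonal (fun i => ((f (d i) : ℝ) : ℂ)) * Wᴴ) * X =
      X * (V * diagonal (fun i => ((f (e i) : ℝ) : ℂ)) * Vᴴ) := by
  have key : diagonal (fun i => ((d i : ℝ) : ℂ)) * (Wᴴ * X * V) =
      (Wᴴ * X * V) * diagonal (fun i => ((e i : ℝ) : ℂ)) := by
    calc _ = (Wᴴ * W) * diagonal (fun i => ((d i : ℝ) : ℂ)) * (Wᴴ * X * V) := by
          rw [hW, Matrix.one_mul]
      _ = Wᴴ * ((W * diagonal (fun i => ((d i : ℝ) : ℂ)) * Wᴴ) * X) * V := by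
          simp only [Matrix.mul_assoc]
      _ = (Wᴴ * X * V) * diagonal (fun i => ((e i : ℝ) : ℂ)) * (Vᴴ * V) := by
          rw [h]; simp only [Matrix.mul_assoc]
      _ = _ := by rw [hV, Matrix.mul_one]
  have key' : diagonal (fun i => ((f (d i) : ℝ) : ℂ)) * (Wᴴ * X * V) =
      (Wᴴ * X * V) * diagonal (fun i => ((f (e i) : ℝ) : ℂ)) := by
    ext i j
    have hij := congrFun (congrFun key i) j
    rw [diagonal_mul, mul_diagonal] at hij ⊢
    by_cases h0 : (Wᴴ * X * V) i j = 0
    · simp [h0]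
    · rw [mul_comm] at hij
      have hde : d i = e j := by exact_mod_cast mul_left_cancel₀ h0 hij
      rw [hde, mul_comm]
  calc _ = W * (diagonal (fun i => ((f (d i) : ℝ) : ℂ)) * (Wᴴ * X * V)) * Vᴴ := by
        simp only [Matrix.mul_assoc, hV', Matrix.mul_one]
    _ = (W * Wᴴ) * X * (V * diagonal (fun i => ((f (e i) : ℝ) : ℂ)) * Vᴴ) := by
        rw [key']; simp only [Matrix.mul_assoc]
    _ = _ := by rw [hW', Matrix.one_mul]

lemma mPow_eq_of_eq_mul_diagonal_mul {M V : Matrix n n ℂ} {e : n → ℝ}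
    (hV : Vᴴ * V = 1) (hV' : V * Vᴴ = 1)
    (h : M = V * diagonal (fun i => ((e i : ℝ) : ℂ)) * Vᴴ) (r : ℝ) :
    mPow M r = V * diagonal (fun i => ((suppRpow r (e i) : ℝ) : ℂ)) * Vᴴ := by
  have hM : M.IsHermitian := by
    rw [h, IsHermitian, conjTranspose_mul, conjTranspose_mul, conjTranspose_conjTranspose,
      diagonal_conjTranspose, Matrix.mul_assoc]
    congr! 3
    ext i
    simp
  have := intertwine_diagonal (X := 1) (suppRpow r)
    (conjTranspose_mul_eigenvectorUnitary hM) (eigenvectorUnitary_mul_conjTranspose hM) hV hV'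
    (by rw [← eq_eigenvectorUnitary_mul_diagonal_mul hM, ← h, Matrix.mul_one, Matrix.one_mul])
  rwa [← mPow_eq hM, Matrix.mul_one, Matrix.one_mul] at this

lemma isHermitian_mPow (M : Matrix n n ℂ) (r : ℝ) : (mPow M r).IsHermitian := by
  by_cases h : M.IsHermitian
  · rw [mPow_eq h, IsHermitian, conjTranspose_mul, conjTranspose_mul, conjTranspose_conjTranspose,
      diagonal_conjTranspose, Matrix.mul_assoc]
    congr! 3
    ext i
    simp
  · simp [mPow, h]

lemma mPow_mul_of_intertwine {M : Matrix m m ℂ} {N : Matrix n n ℂ} {X : Matrix m n ℂ}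
    (hM : M.IsHermitian) (hN : N.IsHermitian) (h : M * X = X * N) (r : ℝ) :
    mPow M r * X = X * mPow N r := by
  rw [mPow_eq hM, mPow_eq hN]
  refine intertwine_diagonal _ (conjTranspose_mul_eigenvectorUnitary hM)
    (eigenvectorUnitary_mul_conjTranspose hM) (conjTranspose_mul_eigenvectorUnitary hN)
    (eigenvectorUnitary_mul_conjTranspose hN) ?_
  rw [← eq_eigenvectorUnitary_mul_diagonal_mul hM, ← eq_eigenvectorUnitary_mul_diagonal_mul hN, h]

lemma mPow_transpose {M : Matrix n n ℂ} (hM : M.IsHermitian) (r : ℝ) :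
    mPow Mᵀ r = (mPow M r)ᵀ := by
  set U := (hM.eigenvectorUnitary : Matrix n n ℂ) with hU
  have e1 : (Uᴴᵀ)ᴴ = Uᵀ := by ext; simp
  rw [mPow_eq_of_eq_mul_diagonal_mul (V := Uᴴᵀ) (e := hM.eigenvalues), mPow_eq hM, e1]
  · simp only [transpose_mul, diagonal_transpose, Matrix.mul_assoc, ← hU]
  · rw [e1, ← transpose_mul, conjTranspose_mul_eigenvectorUnitary hM, transpose_one]
  · rw [e1, ← transpose_mul, eigenvectorUnitary_mul_conjTranspose hM, transpose_one]
  · rw [e1]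
    conv_lhs => rw [eq_eigenvectorUnitary_mul_diagonal_mul hM]
    simp only [transpose_mul, diagonal_transpose, Matrix.mul_assoc, ← hU]

lemma mPow_kronecker {M : Matrix m m ℂ} {N : Matrix n n ℂ}
    (hM : M.PosSemidef) (hN : N.PosSemidef) (r : ℝ) :
    mPow (M ⊗ₖ N) r = mPow M r ⊗ₖ mPow N r := by
  set U := (hM.1.eigenvectorUnitary : Matrix m m ℂ) with hU
  set V := (hN.1.eigenvectorUnitary : Matrix n n ℂ) with hV
  rw [mPow_eq_of_eq_mul_diagonal_mul (V := U ⊗ₖ V)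
    (e := fun p => hM.1.eigenvalues p.1 * hN.1.eigenvalues p.2), mPow_eq hM.1, mPow_eq hN.1]
  · rw [mul_kronecker_mul, mul_kronecker_mul, conjTranspose_kronecker,
      diagonal_kronecker_diagonal]
    simp only [suppRpow_mul (hM.eigenvalues_nonneg _) (hN.eigenvalues_nonneg _),
      Complex.ofReal_mul, ← hU, ← hV]
  · rw [conjTranspose_kronecker, ← mul_kronecker_mul, conjTranspose_mul_eigenvectorUnitary,
      conjTranspose_mul_eigenvectorUnitary, one_kronecker_one]
  · rw [conjTranspose_kronecker, ← mul_kronecker_mul, eigenvectorUnitary_mul_conjTranspose,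
      eigenvectorUnitary_mul_conjTranspose, one_kronecker_one]
  · conv_lhs => rw [eq_eigenvectorUnitary_mul_diagonal_mul hM.1,
      eq_eigenvectorUnitary_mul_diagonal_mul hN.1]
    rw [mul_kronecker_mul, mul_kronecker_mul, conjTranspose_kronecker,
      diagonal_kronecker_diagonal]
    simp only [Complex.ofReal_mul, ← hU, ← hV]

/-- A Hermitian matrix with `N ^ 2 = c N` has `N ^ r = c ^ (r - 1) N`. -/
lemma mPow_eq_smul_of_mul_self {N : Matrix n n ℂ} (hN : N.IsHermitian) {c : ℝ}
    (h : N * N = (c : ℂ) • N) (r : ℝ) :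
    mPow N r = ((c ^ (r - 1) : ℝ) : ℂ) • N := by
  set U := (hN.eigenvectorUnitary : Matrix n n ℂ) with hU
  have hU1 : Uᴴ * U = 1 := conjTranspose_mul_eigenvectorUnitary hN
  have hD : Uᴴ * N * U = diagonal (fun i => ((hN.eigenvalues i : ℝ) : ℂ)) := by
    conv_lhs => rw [eq_eigenvectorUnitary_mul_diagonal_mul hN]
    calc _ = (Uᴴ * U) * diagonal (fun i => ((hN.eigenvalues i : ℝ) : ℂ)) * (Uᴴ * U) := by
          simp only [Matrix.mul_assoc, ← hU]
      _ = _ := by rw [hU1, Matrix.one_mul, Matrix.mul_one]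
  have hDD : diagonal (fun i => ((hN.eigenvalues i : ℝ) : ℂ)) *
      diagonal (fun i => ((hN.eigenvalues i : ℝ) : ℂ)) =
      (c : ℂ) • diagonal (fun i => ((hN.eigenvalues i : ℝ) : ℂ)) := by
    have hU2 : U * Uᴴ = 1 := eigenvectorUnitary_mul_conjTranspose hN
    calc _ = Uᴴ * N * (U * Uᴴ) * N * U := by
          rw [← hD]; simp only [Matrix.mul_assoc]
      _ = Uᴴ * (N * N) * U := by
          rw [hU2, Matrix.mul_one]; simp only [Matrix.mul_assoc]
      _ = _ := by rw [h, ← hD, Matrix.mul_smul, Matrix.smul_mul]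
  have hev : ∀ i, suppRpow r (hN.eigenvalues i) = c ^ (r - 1) * hN.eigenvalues i := by
    intro i
    have hi := congrFun (congrFun hDD i) i
    rw [diagonal_mul_diagonal, Matrix.smul_apply, diagonal_apply_eq, diagonal_apply_eq,
      smul_eq_mul] at hi
    have hi' : hN.eigenvalues i * hN.eigenvalues i = c * hN.eigenvalues i := by exact_mod_cast hi
    unfold suppRpow
    split_ifs with h0
    · simp [h0]
    · have hc := mul_right_cancel₀ h0 hi'
      rw [← hc, Real.rpow_sub_one h0, div_mul_cancel₀ _ h0]
  rw [mPow_eq hN]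
  conv_rhs => rw [eq_eigenvectorUnitary_mul_diagonal_mul hN]
  rw [← Matrix.smul_mul, ← Matrix.mul_smul, ← diagonal_smul]
  congr! 3
  ext i
  simp [hev]

/-- `Tr (|φ⟩⟨φ| ^ r) = ‖φ‖ ^ (2 r)`. -/
lemma trace_mPow_vecMulVec_star {φ : n → ℂ} {c : ℝ} (hc : star φ ⬝ᵥ φ = (c : ℂ))
    {r : ℝ} (hr : 0 < r) (hc0 : 0 ≤ c) :
    (mPow (vecMulVec φ (star φ)) r).trace = ((c ^ r : ℝ) : ℂ) := by
  rw [mPow_eq_smul_of_mul_self (c := c) (posSemidef_vecMulVec_self_star φ).1, trace_smul,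
    trace_vecMulVec, dotProduct_comm, hc, smul_eq_mul, ← Complex.ofReal_mul]
  · rcases hc0.eq_or_lt with h | h
    · simp [← h, Real.zero_rpow hr.ne']
    · rw [Real.rpow_sub_one h.ne', div_mul_cancel₀ _ h.ne']
  · rw [vecMulVec_mul_vecMulVec, hc]
    ext i j
    simp only [vecMulVec_apply, Matrix.smul_apply, Pi.smul_apply, smul_eq_mul]
    ring

/-- `Tr (M^s M^s M M^s M^s) = ∑ pᵢ ^ (1 + 4 s)` over the nonzero eigenvalues. -/
lemma trace_mPow_sandwich {M : Matrix n n ℂ} (hM : M.PosSemidef) (s : ℝ) :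
    (mPow M s * mPow M s * M * mPow M s * mPow M s).trace =
      ((∑ i with hM.1.eigenvalues i ≠ 0, hM.1.eigenvalues i ^ (1 + 4 * s) : ℝ) : ℂ) := by
  set U := (hM.1.eigenvectorUnitary : Matrix n n ℂ) with hU
  set F := diagonal (fun i => ((suppRpow s (hM.1.eigenvalues i) : ℝ) : ℂ)) with hF
  set D := diagonal (fun i => ((hM.1.eigenvalues i : ℝ) : ℂ)) with hD
  have hU1 : Uᴴ * U = 1 := conjTranspose_mul_eigenvectorUnitary hM.1
  have hP : mPow M s = U * F * Uᴴ := mPow_eq hM.1 s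
  have hMe : M = U * D * Uᴴ := eq_eigenvectorUnitary_mul_diagonal_mul hM.1
  have hmul : ∀ X Y : Matrix n n ℂ, (U * X * Uᴴ) * (U * Y * Uᴴ) = U * (X * Y) * Uᴴ := by
    intro X Y
    calc _ = U * X * (Uᴴ * U) * Y * Uᴴ := by simp only [Matrix.mul_assoc]
      _ = _ := by rw [hU1, Matrix.mul_one]; simp only [Matrix.mul_assoc]
  have : mPow M s * mPow M s * M * mPow M s * mPow M s = U * (F * F * D * F * F) * Uᴴ := by
    calc _ = (U * F * Uᴴ) * (U * F * Uᴴ) * (U * D * Uᴴ) * (U * F * Uᴴ) * (U * F * Uᴴ) := by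
          rw [← hP, ← hMe]
      _ = _ := by simp only [hmul]
  rw [this, trace_mul_comm, ← Matrix.mul_assoc, hU1, Matrix.one_mul, hF, hD]
  simp only [diagonal_mul_diagonal, trace_diagonal]
  rw [Finset.sum_filter, Complex.ofReal_sum]
  refine Finset.sum_congr rfl fun i _ => ?_
  by_cases h0 : hM.1.eigenvalues i = 0
  · simp [h0]
  · have hpos : 0 < hM.1.eigenvalues i := lt_of_le_of_ne (hM.eigenvalues_nonneg i) (Ne.symm h0)
    rw [if_pos h0]
    simp only [suppRpow, if_neg h0]
    norm_cast
    rw [show 1 + 4 * s = s + s + 1 + s + s by ring]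
    simp only [Real.rpow_add hpos, Real.rpow_one]

/-- The squared norm of `(ρ_A^s ⊗ ρ_B^s) ψ`, in terms of `ρ_B`. -/
lemma star_dotProduct_mPow_kronecker_mulVec (ψ : m × n → ℂ) (s : ℝ) :
    let ρ := vecMulVec ψ (star ψ)
    let φ := (mPow (ptraceB ρ) s ⊗ₖ mPow (ptraceA ρ) s) *ᵥ ψ
    star φ ⬝ᵥ φ = (mPow (ptraceA ρ) s * mPow (ptraceA ρ) s * ptraceA ρ *
      mPow (ptraceA ρ) s * mPow (ptraceA ρ) s).trace := by
  intro ρ φ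
  set M : Matrix m n ℂ := of fun a b => ψ (a, b) with hM
  have hA : ptraceB ρ = M * Mᴴ := ptraceB_vecMulVec ψ
  have hB : ptraceA ρ = Mᵀ * Mᵀᴴ := ptraceA_vecMulVec ψ
  have hBt : (ptraceA ρ)ᵀ = Mᴴ * M := by
    rw [hB, transpose_mul, transpose_transpose]
    rfl
  have hAh : (ptraceB ρ).IsHermitian := hA ▸ isHermitian_mul_conjTranspose_self M
  have hBh : (ptraceA ρ).IsHermitian := hB ▸ isHermitian_mul_conjTranspose_self Mᵀ
  set P := (mPow (ptraceA ρ) s)ᵀ with hP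
  have hPh : Pᴴ = P := by
    rw [hP]
    exact (isHermitian_mPow _ s).transpose
  have hint : mPow (ptraceB ρ) s * M = M * P := by
    rw [hP, ← mPow_transpose hBh]
    refine mPow_mul_of_intertwine hAh ?_ ?_ s
    · rw [hBt]; exact isHermitian_conjTranspose_mul_self M
    · rw [hA, hBt, Matrix.mul_assoc]
  have hφ : (of fun a b => φ (a, b) : Matrix m n ℂ) = M * P * P := by
    rw [← hint]
    ext a b
    exact kronecker_mulVec_apply _ _ ψ a b
  rw [star_dotProduct_self_eq_trace, hφ, ← trace_transpose (_ * ptraceA ρ * _ * _)]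
  simp only [conjTranspose_mul, transpose_mul, hPh, hBt, ← hP, Matrix.mul_assoc]

end MatrixPower

/-- Schmidt-rank bound: for a pure state `ρ_{AB} = |ψ⟩⟨ψ|` with Schmidt rank `r` and
`α ∈ (1,2)`, `D̃_α(ρ_{AB} ‖ ρ_A ⊗ ρ_B) ≤ 2·log r`. -/
theorem sandwiched_renyi_mutual_information_pure_state_le_log_rank
    {dA dB : ℕ} (hdA : 0 < dA) (hdB : 0 < dB)
    (ψ : Fin dA × Fin dB → ℂ) (hψ : ∑ z, ‖ψ z‖ ^ 2 = 1)
    (ρAB : Matrix (Fin dA × Fin dB) (Fin dA × Fin dB) ℂ)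
    (hρAB : ρAB = Matrix.vecMulVec ψ (star ψ))
    (r : ℕ) (hr : r = (ptraceB ρAB).rank)
    (α : ℝ) (hα : α ∈ Set.Ioo (1:ℝ) 2) :
    sandwichedRenyiDiv α ρAB (ptraceB ρAB ⊗ₖ ptraceA ρAB) ≤ 2 * Real.log r := by
  obtain ⟨h1, h2⟩ := hα
  have hα0 : 0 < α := by linarith
  set s := (1 - α) / (2 * α) with hs
  have hA : (ptraceB ρAB).PosSemidef := by
    rw [hρAB, ptraceB_vecMulVec]; exact posSemidef_self_mul_conjTranspose _
  have hB : (ptraceA ρAB).PosSemidef := by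
    rw [hρAB, ptraceA_vecMulVec]; exact posSemidef_self_mul_conjTranspose _
  have hrank : (ptraceA ρAB).rank = r := by
    rw [hr, hρAB, ptraceA_vecMulVec, ptraceB_vecMulVec, rank_self_mul_conjTranspose,
      rank_self_mul_conjTranspose, rank_transpose]
  have hcard : Fintype.card {i // hB.1.eigenvalues i ≠ 0} = r := by
    rw [← hrank, hB.1.rank_eq_card_non_zero_eigs]
  have hsum : ∑ i, hB.1.eigenvalues i = 1 := by
    have ht : (ptraceA ρAB).trace = 1 := by
      have hψ' : ∑ z, ψ z * star (ψ z) = 1 := by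
        have : ∀ z, ψ z * star (ψ z) = ((‖ψ z‖ ^ 2 : ℝ) : ℂ) := fun z => by
          rw [Complex.star_def, Complex.mul_conj, Complex.normSq_eq_norm_sq]
        simp only [this]
        rw [← Complex.ofReal_sum, hψ, Complex.ofReal_one]
      rw [← hψ', Fintype.sum_prod_type, Finset.sum_comm, hρAB]
      rfl
    rw [hB.1.trace_eq_sum_eigenvalues] at ht
    exact Complex.ofReal_injective (by simpa using ht)
  have hq : 1 + 4 * s = (2 - α) / α := by rw [hs]; field_simp; ring
  have hq0 : 0 < 1 + 4 * s := by rw [hq]; exact div_pos (by linarith) hα0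
  have hq1 : 1 + 4 * s ≤ 1 := by rw [hq, div_le_one hα0]; linarith
  set c := ∑ i with hB.1.eigenvalues i ≠ 0, hB.1.eigenvalues i ^ (1 + 4 * s) with hc
  have hc0 : 0 ≤ c := Finset.sum_nonneg fun i _ => Real.rpow_nonneg (hB.eigenvalues_nonneg i) _
  have hcr : c ≤ (r : ℝ) ^ (1 - (1 + 4 * s)) := by
    rw [← hcard]
    exact sum_rpow_support_le hB.eigenvalues_nonneg hsum hq0 hq1
  set Q := mPow (ptraceB ρAB) s ⊗ₖ mPow (ptraceA ρAB) s with hQ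
  have hQh : Qᴴ = Q := by
    rw [hQ, conjTranspose_kronecker, isHermitian_mPow, isHermitian_mPow]
  have hφ : star (Q *ᵥ ψ) ⬝ᵥ (Q *ᵥ ψ) = (c : ℂ) := by
    rw [hc, ← trace_mPow_sandwich hB s, hQ]
    simpa only [hρAB] using star_dotProduct_mPow_kronecker_mulVec ψ s
  have hsand : Q * ρAB * Q = vecMulVec (Q *ᵥ ψ) (star (Q *ᵥ ψ)) := by
    rw [hρAB, mul_vecMulVec, vecMulVec_mul, star_mulVec, hQh]
  have hlog : Real.log c ≤ (2 * (α - 1) / α) * Real.log r := by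
    rcases hc0.eq_or_lt with h | h
    · rw [← h, Real.log_zero]
      exact mul_nonneg (div_nonneg (by linarith) hα0.le) (Real.log_natCast_nonneg r)
    · have hr0 : (0 : ℝ) < r := by
        rcases Nat.eq_zero_or_pos r with h0 | h0
        · have : IsEmpty {i // hB.1.eigenvalues i ≠ 0} := Fintype.card_eq_zero_iff.1 (hcard.trans h0)
          have hz : ∀ i, hB.1.eigenvalues i = 0 := fun i => by
            by_contra hi; exact this.false ⟨i, hi⟩
          simp [hz] at hsum
        · exact_mod_cast h0
      have := Real.log_le_log h hcr
      rw [Real.log_rpow hr0] at this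
      convert this using 2
      rw [hs]; field_simp; ring
  unfold sandwichedRenyiDiv
  rw [← hs, mPow_kronecker hA hB, ← hQ, hsand, trace_mPow_vecMulVec_star hφ hα0 hc0,
    Complex.ofReal_re]
  have hrpow : Real.log (c ^ α) = α * Real.log c := by
    rcases hc0.eq_or_lt with h | h
    · simp [← h, Real.zero_rpow hα0.ne']
    · exact Real.log_rpow h α
  have hα1 : 0 < α - 1 := by linarith
  rw [hrpow, inv_mul_le_iff₀ hα1]
  calc α * Real.log c ≤ α * ((2 * (α - 1) / α) * Real.log r) := by gcongr
    _ = (α - 1) * (2 * Real.log r) := by field_simp
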